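/- Let R be a Noetherian local ring and G ⊆ GL_n(R) a finite subgroup, and set S = R[x_1,…,x_n]. Then S^G contains a homogeneous system of parameters, i.e. there exist homogeneous invariants f_1,…,f_n ∈ S^G of positive degree that are algebraically independent over R and such that S^G is finitely generated as a module over R[f_1,…,f_n]. -/

import Mathlib

open MvPolynomial TensorProduct

set_option synthInstance.maxHeartbeats 1000000
set_option maxHeartbeats 1000000

/-- The action of `σ ∈ GLₙ(R)` on the polynomial ring `R[x₁,…,xₙ]`,
given by `σ(f) = f(σ⁻¹ (x₁,…,xₙ))`. -/
noncomputable def glAct {R : Type*} [CommRing R] {n : ℕ}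
    (σ : Matrix.GeneralLinearGroup (Fin n) R) :
    MvPolynomial (Fin n) R →ₐ[R] MvPolynomial (Fin n) R :=
  MvPolynomial.aeval fun i =>
    ∑ j, ((σ⁻¹ : Matrix.GeneralLinearGroup (Fin n) R) : Matrix (Fin n) (Fin n) R) i j •
      MvPolynomial.X j

/-- The ring of invariants `R[x₁,…,xₙ]^G` of a subgroup `G ⊆ GLₙ(R)`,
as a subalgebra of `R[x₁,…,xₙ]`. -/
noncomputable def invariants {R : Type*} [CommRing R] {n : ℕ}
    (G : Subgroup (Matrix.GeneralLinearGroup (Fin n) R)) :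
    Subalgebra R (MvPolynomial (Fin n) R) :=
  ⨅ σ ∈ G, AlgHom.equalizer (glAct σ) (AlgHom.id R _)

/-- The map `GLₙ(R) → GLₙ(R')` induced by a ring homomorphism `R → R'`. -/
noncomputable def glMap {R R' : Type*} [CommRing R] [CommRing R'] {n : ℕ} (f : R →+* R') :
    Matrix.GeneralLinearGroup (Fin n) R →* Matrix.GeneralLinearGroup (Fin n) R' :=
  Units.map (RingHom.toMonoidHom (RingHom.mapMatrix f))

/-- `R[x₁,…,xₙ]^G` is generated as an `R`-algebra by its homogeneous elements of
degree at most `d`. -/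
def genByDeg {n : ℕ} (R : Type*) [CommRing R]
    (G : Subgroup (Matrix.GeneralLinearGroup (Fin n) R)) (d : ℕ) : Prop :=
  Algebra.adjoin R {f : MvPolynomial (Fin n) R |
    f ∈ invariants G ∧ ∃ i ≤ d, MvPolynomial.IsHomogeneous f i} = invariants G

/-- `f₁, …, fₘ` is a homogeneous system of parameters for `R[x₁,…,xₙ]^G`:
the `fᵢ` are invariant, homogeneous of positive degree, algebraically independent over `R`,
and `R[x₁,…,xₙ]^G` is a finitely generated module over `R[f₁,…,fₘ]`. -/
def IsHSOPInv {n m : ℕ} {R : Type*} [CommRing R]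
    (G : Subgroup (Matrix.GeneralLinearGroup (Fin n) R))
    (f : Fin m → MvPolynomial (Fin n) R) : Prop :=
  (∀ i, f i ∈ invariants G) ∧
  (∀ i, ∃ d : ℕ, 0 < d ∧ (f i).IsHomogeneous d) ∧
  AlgebraicIndependent R f ∧
  ∃ s : Finset (MvPolynomial (Fin n) R),
    ↑s ⊆ (invariants G : Set (MvPolynomial (Fin n) R)) ∧
    (invariants G : Set (MvPolynomial (Fin n) R)) ⊆
      (Submodule.span (Algebra.adjoin R (Set.range f)) (s : Set (MvPolynomial (Fin n) R)) :
        Submodule (Algebra.adjoin R (Set.range f)) (MvPolynomial (Fin n) R))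

/-- A commutative ring `T` is Cohen-Macaulay if for every maximal ideal `P` of `T`,
the localization `T_P` contains a regular sequence lying in its maximal ideal whose
length equals the Krull dimension of `T_P` (i.e. `depth T_P = dim T_P`). -/
def IsCohenMacaulayRing (T : Type*) [CommRing T] : Prop :=
  ∀ (P : Ideal T) (hP : P.IsMaximal),
    haveI : P.IsPrime := hP.isPrime
    ∃ rs : List (Localization.AtPrime P),
      (∀ r ∈ rs, r ∈ IsLocalRing.maximalIdeal (Localization.AtPrime P)) ∧
      RingTheory.Sequence.IsRegular (Localization.AtPrime P) rs ∧
      (rs.length : WithBot ℕ∞) = ringKrullDim (Localization.AtPrime P)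


open MvPolynomial

section gl
variable {R : Type*} [CommRing R] {n : ℕ}

theorem glAct_X (σ : Matrix.GeneralLinearGroup (Fin n) R) (i : Fin n) :
    glAct σ (X i) = ∑ j, ((σ⁻¹ : Matrix.GeneralLinearGroup (Fin n) R) :
      Matrix (Fin n) (Fin n) R) i j • (X j : MvPolynomial (Fin n) R) := by
  simp [glAct]

theorem glAct_mul (σ τ : Matrix.GeneralLinearGroup (Fin n) R) (p : MvPolynomial (Fin n) R) :
    glAct (σ * τ) p = glAct σ (glAct τ p) := by
  have : glAct (σ * τ) = (glAct σ).comp (glAct τ) := by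
    apply MvPolynomial.algHom_ext
    intro i
    rw [AlgHom.comp_apply, glAct_X, glAct_X, map_sum]
    simp only [map_smul, glAct_X, mul_inv_rev, Units.val_mul, Matrix.mul_apply, Finset.sum_smul,
      Finset.smul_sum, smul_smul]
    rw [Finset.sum_comm]
  rw [this]; rfl

theorem glAct_homog (σ : Matrix.GeneralLinearGroup (Fin n) R) {p : MvPolynomial (Fin n) R}
    {d : ℕ} (hp : p.IsHomogeneous d) : (glAct σ p).IsHomogeneous d := by
  have := hp.aeval (fun i => ∑ j, ((σ⁻¹ : Matrix.GeneralLinearGroup (Fin n) R) :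
      Matrix (Fin n) (Fin n) R) i j • (X j : MvPolynomial (Fin n) R)) (n := 1) (by
        intro i
        apply IsHomogeneous.sum
        intro j _
        rw [smul_eq_C_mul]
        exact isHomogeneous_C_mul_X _ _)
  rwa [one_mul] at this

theorem glAct_map {K : Type*} [CommRing K] (π : R →+* K)
    (σ : Matrix.GeneralLinearGroup (Fin n) R) (p : MvPolynomial (Fin n) R) :
    map π (glAct σ p) = glAct (glMap π σ) (map π p) := by
  have : (map π).comp (glAct σ).toRingHom = (glAct (glMap π σ)).toRingHom.comp (map π) := by
    apply MvPolynomial.ringHom_ext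
    · intro r; simp [← algebraMap_eq, glAct]
    · intro i
      simp only [RingHom.comp_apply, AlgHom.toRingHom_eq_coe, RingHom.coe_coe, map_X, glAct_X,
        map_sum, smul_eq_C_mul, map_mul, map_C]
      rw [← map_inv]
      rfl
  exact RingHom.congr_fun this p

theorem mem_invariants (G : Subgroup (Matrix.GeneralLinearGroup (Fin n) R))
    (p : MvPolynomial (Fin n) R) : p ∈ invariants G ↔ ∀ σ ∈ G, glAct σ p = p := by
  simp [invariants, Algebra.mem_iInf, AlgHom.mem_equalizer]

theorem norm_mem_invariants (G : Subgroup (Matrix.GeneralLinearGroup (Fin n) R)) [Fintype G]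
    (p : MvPolynomial (Fin n) R) : ∏ σ : G, glAct σ.1 p ∈ invariants G := by
  rw [mem_invariants]
  intro τ hτ
  rw [map_prod]
  simp only [← glAct_mul]
  exact Fintype.prod_equiv (Equiv.mulLeft (⟨τ, hτ⟩ : G)) _ _ (fun σ => rfl)
end gl

theorem homogeneousComponent_mul_homog {σ R : Type*} [CommRing R] {f : MvPolynomial σ R} {e : ℕ}
    (hf : f.IsHomogeneous e) (g : MvPolynomial σ R) (d : ℕ) :
    homogeneousComponent d (g * f) =
      if e ≤ d then homogeneousComponent (d - e) g * f else 0 := by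
  conv_lhs => rw [← sum_homogeneousComponent g, Finset.sum_mul, map_sum]
  have h : ∀ i, homogeneousComponent d (homogeneousComponent i g * f) =
      if d = i + e then homogeneousComponent i g * f else 0 := fun i =>
    homogeneousComponent_of_mem ((homogeneousComponent_isHomogeneous i g).mul hf)
  simp only [h]
  split_ifs with hed
  · rw [Finset.sum_eq_single (d - e)]
    · rw [if_pos (by omega)]
    · intro b _ hb
      rw [if_neg (by omega)]
    · intro hb
      rw [if_pos (by omega), homogeneousComponent_eq_zero _ _ (by simp at hb; omega), zero_mul]
  · exact Finset.sum_eq_zero fun i _ => if_neg (by omega)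

theorem finite_of_radical {n m : ℕ} {R K : Type*} [CommRing R] [CommRing K] (π : R →+* K)
    (hπ : Function.Surjective π) (hker : RingHom.ker π ≤ Ideal.jacobson ⊥)
    (f : Fin m → MvPolynomial (Fin n) R) (d : Fin m → ℕ) (hd : ∀ i, 0 < d i)
    (hf : ∀ i, (f i).IsHomogeneous (d i))
    (hX : ∀ j, (X j : MvPolynomial (Fin n) K) ∈
      (Ideal.span (Set.range fun i => map π (f i))).radical) :
    Module.Finite (Algebra.adjoin R (Set.range f)) (MvPolynomial (Fin n) R) := by
  classical
  obtain ⟨D, hD⟩ := Ideal.exists_pow_le_of_le_radical_of_fg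
    (I := idealOfVars (Fin n) K) (J := Ideal.span (Set.range fun i => map π (f i)))
    (by rw [idealOfVars, Ideal.span_le]; rintro _ ⟨j, rfl⟩; exact hX j) (idealOfVars_fg _ _)
  set B := Algebra.adjoin R (Set.range f)
  choose s hs using fun e : ℕ => homogeneousSubmodule_fg (Fin n) R e
  let T : Finset (MvPolynomial (Fin n) R) := (Finset.range D).biUnion s
  let M : Submodule B (MvPolynomial (Fin n) R) := Submodule.span B (T : Set _)
  have key : ∀ e, homogeneousSubmodule (Fin n) R e ≤ M.restrictScalars R := by
    intro e
    induction e using Nat.strong_induction_on with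
    | _ e ih =>
    rcases lt_or_ge e D with h | h
    · rw [← hs e, Submodule.span_le]
      intro x hx
      exact Submodule.subset_span (by
        simp only [T, Finset.coe_biUnion, Set.mem_iUnion]
        exact ⟨e, by simpa using h, hx⟩)
    · refine Submodule.le_of_le_smul_of_le_jacobson_bot (homogeneousSubmodule_fg _ _ _) hker ?_
      intro p hp
      rw [mem_homogeneousSubmodule] at hp
      have h1 : map π p ∈ Ideal.span (Set.range fun i => map π (f i)) := by
        apply hD
        rw [mem_pow_idealOfVars_iff']
        intro x hx
        exact (hp.map π).coeff_eq_zero (by omega)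
      obtain ⟨c, hc⟩ := (Ideal.mem_span_range_iff_exists_fun).1 h1
      choose g hg using fun i => map_surjective π hπ (c i)
      let q := p - homogeneousComponent e (∑ i, g i * f i)
      have hq : q ∈ RingHom.ker π • homogeneousSubmodule (Fin n) R e := by
        have hqh : q.IsHomogeneous e := hp.sub (homogeneousComponent_isHomogeneous _ _)
        rw [q.as_sum]
        refine Submodule.sum_mem _ fun v hv => ?_
        rw [show monomial v (coeff v q) = coeff v q • monomial v (1 : R) by
          rw [smul_monomial, smul_eq_mul, mul_one]]
        have hv' : v.degree = e := by
          by_contra hne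
          exact (mem_support_iff.1 hv) (hqh.coeff_eq_zero hne)
        refine Submodule.smul_mem_smul ?_ ?_
        · rw [RingHom.mem_ker, coeff_sub, map_sub, coeff_homogeneousComponent, if_pos hv',
            ← coeff_map, ← coeff_map, ← coeff_sub, ← hc]
          simp [hg]
        · exact isHomogeneous_monomial _ hv'
      have hp' : p = homogeneousComponent e (∑ i, g i * f i) + q := by simp [q]
      rw [hp']
      refine Submodule.add_mem_sup ?_ hq
      rw [map_sum]
      refine Submodule.sum_mem _ fun i _ => ?_
      rw [homogeneousComponent_mul_homog (hf i)]
      split_ifs with hi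
      · have h2 : homogeneousComponent (e - d i) (g i) ∈ M :=
          ih (e - d i) (by have := hd i; omega) (homogeneousComponent_isHomogeneous _ _)
        have h3 := M.smul_mem (⟨f i, Algebra.subset_adjoin ⟨i, rfl⟩⟩ : B) h2
        rw [Subalgebra.smul_def, smul_eq_mul, mul_comm] at h3
        exact h3
      · exact Submodule.zero_mem _
  refine ⟨⟨T, ?_⟩⟩
  rw [eq_top_iff]
  intro p _
  rw [← sum_homogeneousComponent p]
  exact Submodule.sum_mem _ fun e _ => key e (homogeneousComponent_isHomogeneous _ _)

theorem algInd_field {n : ℕ} {K : Type*} [Field K]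
    (f : Fin n → MvPolynomial (Fin n) K) (d : Fin n → ℕ) (hd : ∀ i, 0 < d i)
    (hf : ∀ i, (f i).IsHomogeneous (d i))
    (hX : ∀ j, (X j : MvPolynomial (Fin n) K) ∈ (Ideal.span (Set.range f)).radical) :
    AlgebraicIndependent K f := by
  have := finite_of_radical (RingHom.id K) Function.surjective_id
    (by intro x hx; simp_all [RingHom.mem_ker]) f d hd hf (by simpa only [MvPolynomial.map_id] using hX)
  have : Algebra.IsAlgebraic (Algebra.adjoin K (Set.range f)) (MvPolynomial (Fin n) K) :=
    inferInstance
  refine (Algebra.IsAlgebraic.isTranscendenceBasis_of_lift_le_trdeg_of_finite K f ?_).1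
  rw [MvPolynomial.trdeg_of_isDomain]
  simp

theorem algInd_iff {ι R A : Type*} [CommRing R] [CommRing A] [Algebra R A] (f : ι → A) :
    AlgebraicIndependent R f ↔
      LinearIndependent R (fun α : ι →₀ ℕ => aeval f (monomial α (1 : R))) := by
  rw [AlgebraicIndependent, LinearIndependent]
  have : ⇑(aeval f : MvPolynomial ι R →ₐ[R] A) =
      (Finsupp.linearCombination R (fun α : ι →₀ ℕ => aeval f (monomial α (1 : R)))) ∘
        (basisMonomials ι R).repr := by
    have h : (aeval f : MvPolynomial ι R →ₐ[R] A).toLinearMap =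
      (Finsupp.linearCombination R (fun α : ι →₀ ℕ => aeval f (monomial α (1 : R)))) ∘ₗ
        (basisMonomials ι R).repr.toLinearMap := by
      apply (basisMonomials ι R).ext
      intro α
      simp only [LinearMap.comp_apply, LinearEquiv.coe_coe, Module.Basis.repr_self]
      simp
    exact congrArg DFunLike.coe h
  exact (congrArg Function.Injective this).to_iff.trans
    ((basisMonomials ι R).repr.toEquiv.injective_comp _)

theorem algInd_lift {n m : ℕ} {R : Type*} [CommRing R] [IsLocalRing R]
    (f : Fin m → MvPolynomial (Fin n) R)
    (h : AlgebraicIndependent (IsLocalRing.ResidueField R)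
      (fun i => map (IsLocalRing.residue R) (f i))) : AlgebraicIndependent R f := by
  rw [algInd_iff] at h ⊢
  apply Module.IsLocalRing.linearIndependent_of_flat
  apply LinearIndependent.of_comp
    (algebraTensorAlgEquiv (σ := Fin n) R (IsLocalRing.ResidueField R)).toLinearMap
  convert! h using 1
  ext1 α
  simp only [Function.comp_apply, AlgEquiv.toLinearMap_apply, TensorProduct.mk_apply,
    algebraTensorAlgEquiv_tmul, one_smul, aeval_monomial, map_one, one_mul, Finsupp.prod, map_prod,
    map_pow]
  rfl

theorem mem_radical_of_primes {n : ℕ} {K : Type*} [Field K] {ι : Type*} [Fintype ι]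
    (ρ : ι → Matrix.GeneralLinearGroup (Fin n) K) (h : Fin n → MvPolynomial (Fin n) K)
    (x : MvPolynomial (Fin n) K)
    (H : ∀ (P : Ideal (MvPolynomial (Fin n) K)) (t : Fin n → ι), P.IsPrime →
      (∀ i, glAct (ρ (t i)) (h i) ∈ P) → x ∈ P) :
    x ∈ (Ideal.span (Set.range fun i => ∏ s, glAct (ρ s) (h i))).radical := by
  rw [Ideal.radical_eq_sInf, Submodule.mem_sInf]
  rintro P ⟨hP, hprime⟩
  rw [Ideal.span_le] at hP
  have : ∀ i, ∃ s, glAct (ρ s) (h i) ∈ P := by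
    intro i
    have h1 : ∏ s, glAct (ρ s) (h i) ∈ P := hP ⟨i, rfl⟩
    obtain ⟨s, _, hs⟩ := (hprime.prod_mem_iff).1 h1
    exact ⟨s, hs⟩
  choose t ht using this
  exact H P t hprime ht

theorem exists_generic {n : ℕ} {K : Type*} [Field K] [Infinite K] {ι : Type*} [Fintype ι]
    (ρ : ι → Matrix (Fin n) (Fin n) K) (ρ' : ι → Matrix (Fin n) (Fin n) K)
    (hρ : ∀ s, ρ' s * ρ s = 1) :
    ∃ a : Matrix (Fin n) (Fin n) K, ∀ t : Fin n → ι,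
      (Matrix.of fun i j => ∑ l, a i l * ρ (t i) l j).det ≠ 0 := by
  classical
  let Q : (Fin n → ι) → MvPolynomial (Fin n × Fin n) K := fun t =>
    (Matrix.of fun i j => ∑ l, X (i, l) * C (ρ (t i) l j)).det
  have hQ : ∀ t (a : Matrix (Fin n) (Fin n) K), eval (fun z => a z.1 z.2) (Q t) =
      (Matrix.of fun i j => ∑ l, a i l * ρ (t i) l j).det := by
    intro t a
    simp only [Q]
    rw [RingHom.map_det]
    congr 1
    ext i j
    simp
  have hne : ∏ t, Q t ≠ 0 := by
    rw [Finset.prod_ne_zero_iff]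
    intro t _ h0
    have := hQ t (fun i l => ρ' (t i) i l)
    rw [h0, map_zero] at this
    have h1 : (Matrix.of fun i j => ∑ l, ρ' (t i) i l * ρ (t i) l j) = 1 := by
      ext i j
      rw [Matrix.of_apply, ← Matrix.mul_apply, hρ]
    rw [h1, Matrix.det_one] at this
    exact zero_ne_one this
  have : ∃ z, eval z (∏ t, Q t) ≠ 0 := by
    by_contra! hz
    exact hne (MvPolynomial.funext (by simpa using hz))
  obtain ⟨z, hz⟩ := this
  refine ⟨fun i j => z (i, j), fun t h0 => ?_⟩
  rw [map_prod, Finset.prod_ne_zero_iff] at hz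
  apply hz t (Finset.mem_univ _)
  exact (hQ t (fun i j => z (i, j))).trans h0

theorem exists_h_infinite {n : ℕ} {K : Type*} [Field K] [Infinite K] {ι : Type*} [Fintype ι]
    (ρ : ι → Matrix.GeneralLinearGroup (Fin n) K) :
    ∃ (h : Fin n → MvPolynomial (Fin n) K) (d : Fin n → ℕ), (∀ i, 0 < d i) ∧
      (∀ i, (h i).IsHomogeneous (d i)) ∧
      ∀ j, X j ∈ (Ideal.span (Set.range fun i => ∏ s, glAct (ρ s) (h i))).radical := by
  obtain ⟨a, ha⟩ := exists_generic (fun s => ((ρ s)⁻¹ : Matrix.GeneralLinearGroup (Fin n) K).1)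
    (fun s => (ρ s).1) (fun s => Units.mul_inv (ρ s))
  refine ⟨fun i => ∑ l, C (a i l) * X l, fun _ => 1, fun _ => one_pos,
    fun i => IsHomogeneous.sum _ _ _ fun l _ => isHomogeneous_C_mul_X _ _, fun j => ?_⟩
  apply mem_radical_of_primes
  intro P t _ hP
  set N : Matrix (Fin n) (Fin n) K := Matrix.of fun i j => ∑ l, a i l *
    ((ρ (t i))⁻¹ : Matrix.GeneralLinearGroup (Fin n) K).1 l j with hN
  have hP' : ∀ i, ∑ l, C (N i l) * X l ∈ P := by
    intro i
    have := hP i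
    convert this using 1
    simp only [map_sum, map_mul, glAct_X, ← algebraMap_eq, AlgHom.commutes]
    simp only [algebraMap_eq, smul_eq_C_mul, Finset.mul_sum, hN, Matrix.of_apply, map_sum,
      map_mul, Finset.sum_mul]
    rw [Finset.sum_comm]
    simp only [mul_assoc]
  have hinv : N⁻¹ * N = 1 := Matrix.nonsing_inv_mul _ (isUnit_iff_ne_zero.2 (ha t))
  have hx : (X j : MvPolynomial (Fin n) K) = ∑ i, C (N⁻¹ j i) * ∑ l, C (N i l) * X l := by
    simp only [Finset.mul_sum]
    rw [Finset.sum_comm]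
    simp only [← mul_assoc, ← Finset.sum_mul, ← map_mul, ← map_sum, ← Matrix.mul_apply, hinv]
    simp [Matrix.one_apply]
  rw [hx]
  exact P.sum_mem fun i _ => P.mul_mem_left _ (hP' i)

theorem prod_sub_smul {K B : Type*} [Field K] [Fintype K] [CommRing B] [Algebra K B] (x y : B) :
    ∏ a : K, (x - a • y) = x ^ Fintype.card K - y ^ (Fintype.card K - 1) * x := by
  classical
  have h0 : ∏ a : K, (Polynomial.X - Polynomial.C a) =
      Polynomial.X ^ Fintype.card K - (Polynomial.X : Polynomial K) := by
    have hdeg := FiniteField.X_pow_card_sub_X_natDegree_eq K (Fintype.one_lt_card (α := K))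
    have hroots := FiniteField.roots_X_pow_card_sub_X K
    have hm : (Polynomial.X ^ Fintype.card K - (Polynomial.X : Polynomial K)).Monic :=
      Polynomial.monic_X_pow_sub (by
        rw [Polynomial.degree_X]; exact_mod_cast Fintype.one_lt_card (α := K))
    have := Polynomial.prod_multiset_X_sub_C_of_monic_of_roots_card_eq hm (by
      rw [hroots, hdeg]; rfl)
    rw [hroots] at this
    exact this
  have huniv : ∏ a : K, ((X 0 : MvPolynomial (Fin 2) K) - a • X 1) =
      X 0 ^ Fintype.card K - X 1 ^ (Fintype.card K - 1) * X 0 := by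
    let F := FractionRing (MvPolynomial (Fin 2) K)
    apply IsFractionRing.injective (MvPolynomial (Fin 2) K) F
    set u : F := algebraMap (MvPolynomial (Fin 2) K) F (X 0)
    set v : F := algebraMap (MvPolynomial (Fin 2) K) F (X 1)
    have hv : v ≠ 0 := by
      intro h
      exact X_ne_zero (R := K) (1 : Fin 2)
        ((IsFractionRing.injective (MvPolynomial (Fin 2) K) F) (by rw [map_zero]; exact h))
    have h1 := congrArg (Polynomial.aeval (u / v)) h0
    rw [map_prod] at h1
    simp only [map_sub, map_pow, Polynomial.aeval_X, Polynomial.aeval_C] at h1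
    have h2 : ∀ a : K, algebraMap (MvPolynomial (Fin 2) K) F (X 0 - a • X 1) =
        v * (u / v - algebraMap K F a) := by
      intro a
      rw [mul_sub, mul_div_cancel₀ _ hv, map_sub, smul_eq_C_mul, map_mul, ← algebraMap_eq,
        ← IsScalarTower.algebraMap_apply]
      ring
    rw [map_prod]
    simp only [h2]
    rw [Finset.prod_mul_distrib, h1]
    simp only [Finset.prod_const, Finset.card_univ, map_sub, map_mul, map_pow]
    rw [mul_sub, ← mul_pow, mul_div_cancel₀ _ hv]
    congr 1
    obtain ⟨m, hm⟩ : ∃ m, Fintype.card K = m + 1 :=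
      ⟨Fintype.card K - 1, by have := Fintype.card_pos (α := K); omega⟩
    rw [hm, pow_succ, mul_assoc, mul_div_cancel₀ _ hv]
    rfl
  have := congrArg (aeval ![x, y]) huniv
  simpa [map_prod] using this

/-- A product of `T - ℓ` over linear forms in the span is an additive polynomial. -/
theorem dickson {K A : Type*} [Field K] [Fintype K] [CommRing A] [Algebra K A] (j : ℕ)
    (y : Fin j → A) : ∃ c : ℕ → A, c j = 1 ∧ ∀ t : Polynomial A,
      ∏ v : Fin j → K, (t - Polynomial.C (∑ i, v i • y i)) =
        ∑ i ∈ Finset.range (j + 1), Polynomial.C (c i) * t ^ (Fintype.card K ^ i) := by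
  induction j with
  | zero => exact ⟨fun _ => 1, rfl, fun t => by simp⟩
  | succ j ih =>
  obtain ⟨c, hc, h⟩ := ih (fun i => y i.castSucc)
  set q := Fintype.card K with hq
  let L : Polynomial A → Polynomial A := fun t =>
    ∑ i ∈ Finset.range (j + 1), Polynomial.C (c i) * t ^ (q ^ i)
  obtain ⟨p, e, hp, hqp⟩ : ∃ p e : ℕ, p.Prime ∧ CharP K p ∧ q = p ^ e := by
    obtain ⟨p, hp⟩ := CharP.exists K
    obtain ⟨e, h1, h2⟩ := FiniteField.card K p
    exact ⟨p, e, h1, hp, h2⟩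
  obtain ⟨hchar, hqe⟩ := hqp
  have := Fact.mk hp
  have hsub : ∀ (x y : Polynomial A) i, (x - y) ^ q ^ i = x ^ q ^ i - y ^ q ^ i := by
    intro x y i
    nontriviality A
    have : CharP (Polynomial A) p := charP_of_injective_algebraMap (FaithfulSMul.algebraMap_injective K (Polynomial A)) p
    rw [hqe, ← pow_mul, sub_pow_char_pow]
  have hadd : ∀ (s : Finset ℕ) (x : ℕ → Polynomial A), (∑ i ∈ s, x i) ^ q = ∑ i ∈ s, x i ^ q := by
    intro s x
    nontriviality A
    have : CharP (Polynomial A) p := charP_of_injective_algebraMap (FaithfulSMul.algebraMap_injective K (Polynomial A)) p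
    rw [hqe, sum_pow_char_pow]
  have hL : ∀ (t : Polynomial A) (a : K) (w : Polynomial A), L (t - a • w) = L t - a • L w := by
    intro t a w
    simp only [L, Finset.smul_sum, ← Finset.sum_sub_distrib]
    refine Finset.sum_congr rfl fun i _ => ?_
    rw [hsub, smul_pow, FiniteField.pow_card_pow, mul_sub, mul_smul_comm]
  let w : A := ∑ i ∈ Finset.range (j + 1), c i * y (Fin.last j) ^ (q ^ i)
  have hw : L (Polynomial.C (y (Fin.last j))) = Polynomial.C w := by
    simp [L, w]
  refine ⟨fun i => (if i = 0 then 0 else c (i - 1) ^ q) - (if i ≤ j then w ^ (q - 1) * c i else 0),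
    by simp [hc], fun t => ?_⟩
  have h1 : ∏ v : Fin (j + 1) → K, (t - Polynomial.C (∑ i, v i • y i)) =
      ∏ a : K, L (t - a • Polynomial.C (y (Fin.last j))) := by
    rw [← (Fin.snocEquiv (fun _ => K)).prod_comp, Fintype.prod_prod_type]
    refine Finset.prod_congr rfl fun a _ => ?_
    refine Eq.trans ?_ (h _)
    refine Finset.prod_congr rfl fun v _ => ?_
    rw [Fin.sum_univ_castSucc]
    simp [Fin.snocEquiv, Polynomial.smul_C]
    ring
  rw [h1]
  simp only [hL]
  rw [prod_sub_smul, hw]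
  simp only [map_sub, sub_mul, Finset.sum_sub_distrib]
  congr 1
  · rw [Finset.sum_range_succ']
    refine (hadd _ _).trans ?_
    simp only [Nat.succ_ne_zero, if_false, if_true, map_zero, zero_mul, add_zero,
      Nat.add_sub_cancel]
    refine Finset.sum_congr rfl fun i _ => ?_
    rw [mul_pow, ← pow_mul, ← pow_succ, map_pow]
  · rw [Finset.sum_range_succ, if_neg (by omega), map_zero, zero_mul, add_zero]
    simp only [L, Finset.mul_sum]
    refine Finset.sum_congr rfl fun i hi => ?_
    rw [if_pos (by have := Finset.mem_range.1 hi; omega), map_mul, map_pow]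
    ring

/-- `P` is homogeneous of total degree `a`. -/
def HomPoly {n : ℕ} {K : Type*} [CommRing K] (P : Polynomial (MvPolynomial (Fin n) K))
    (a : ℕ) : Prop :=
  (∀ i j, i + j = a → (P.coeff i).IsHomogeneous j) ∧ ∀ i, a < i → P.coeff i = 0

theorem homPoly_prod {n : ℕ} {K : Type*} [CommRing K] {ι : Type*} (s : Finset ι)
    (l : ι → MvPolynomial (Fin n) K) (hl : ∀ v, (l v).IsHomogeneous 1) :
    HomPoly (∏ v ∈ s, (Polynomial.X - Polynomial.C (l v))) s.card := by
  classical
  induction s using Finset.induction_on with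
  | empty =>
    constructor
    · intro i j hij
      simp only [Finset.card_empty, Nat.add_eq_zero_iff] at hij
      obtain ⟨rfl, rfl⟩ := hij
      simpa using isHomogeneous_one _ _
    · intro i hi
      simp only [Finset.prod_empty, Polynomial.coeff_one]
      rw [if_neg]; simp at hi; omega
  | insert v s hv ih =>
    rw [Finset.prod_insert hv, Finset.card_insert_of_notMem hv]
    obtain ⟨h1, h2⟩ := ih
    constructor
    · intro i j hij
      rw [sub_mul, Polynomial.coeff_sub, Polynomial.coeff_C_mul]
      apply IsHomogeneous.sub
      · cases i with
        | zero => simpa using isHomogeneous_zero _ _ _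
        | succ i =>
          rw [Polynomial.coeff_X_mul]
          exact h1 _ _ (by omega)
      · cases j with
        | zero => rw [h2 i (by omega), mul_zero]; exact isHomogeneous_zero _ _ _
        | succ j =>
          rw [add_comm j 1]
          exact (hl v).mul (h1 _ _ (by omega))
    · intro i hi
      rw [sub_mul, Polynomial.coeff_sub, Polynomial.coeff_C_mul, h2 i (by omega)]
      cases i with
      | zero => omega
      | succ i => rw [Polynomial.coeff_X_mul, h2 i (by omega)]; simp

theorem exists_h_finite {n : ℕ} {K : Type*} [Field K] [Finite K] {ι : Type*} [Fintype ι]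
    (ρ : ι → Matrix.GeneralLinearGroup (Fin n) K) :
    ∃ (h : Fin n → MvPolynomial (Fin n) K) (d : Fin n → ℕ), (∀ i, 0 < d i) ∧
      (∀ i, (h i).IsHomogeneous (d i)) ∧
      ∀ j, X j ∈ (Ideal.span (Set.range fun i => ∏ s, glAct (ρ s) (h i))).radical := by
  classical
  have := Fintype.ofFinite K
  set q := Fintype.card K with hq
  have hq1 : 1 < q := Fintype.one_lt_card
  let l : (Fin n → K) → MvPolynomial (Fin n) K := fun v => ∑ i, v i • X i
  let F : Polynomial (MvPolynomial (Fin n) K) := ∏ v, (Polynomial.X - Polynomial.C (l v))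
  have hF : HomPoly F (q ^ n) := by
    have := homPoly_prod (Finset.univ : Finset (Fin n → K)) l (fun v =>
      IsHomogeneous.sum _ _ _ fun i _ => by
        rw [smul_eq_C_mul]; exact isHomogeneous_C_mul_X _ _)
    simpa [hq] using this
  obtain ⟨c, hc1, hc⟩ := dickson (K := K) n (fun i => (X i : MvPolynomial (Fin n) K))
  have hFc : F = ∑ i ∈ Finset.range (n + 1), Polynomial.C (c i) * Polynomial.X ^ (q ^ i) :=
    hc Polynomial.X
  have hcoef : ∀ i ≤ n, F.coeff (q ^ i) = c i := by
    intro i hi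
    rw [hFc, Polynomial.finsetSum_coeff]
    simp only [Polynomial.coeff_C_mul, Polynomial.coeff_X_pow]
    rw [Finset.sum_eq_single i]
    · simp
    · intro b _ hb
      rw [if_neg, mul_zero]
      intro h
      exact hb (Nat.pow_right_injective hq1 h).symm
    · intro h; simp at h; omega
  have hinv : ∀ σ : Matrix.GeneralLinearGroup (Fin n) K, ∀ m,
      glAct σ (F.coeff m) = F.coeff m := by
    intro σ m
    have hl : ∀ v, glAct σ (l v) =
        l (Matrix.vecMul v ((σ⁻¹ : Matrix.GeneralLinearGroup (Fin n) K).1)) := by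
      intro v
      simp only [l, map_sum, map_smul, glAct_X, Finset.smul_sum, smul_smul, Matrix.vecMul,
        dotProduct, Finset.sum_smul]
      rw [Finset.sum_comm]
    have hmap : F.map (glAct σ : MvPolynomial (Fin n) K →+* MvPolynomial (Fin n) K) = F := by
      simp only [F, Polynomial.map_prod, Polynomial.map_sub, Polynomial.map_X, Polynomial.map_C,
        RingHom.coe_coe, hl]
      let e : (Fin n → K) ≃ (Fin n → K) :=
        { toFun := fun v => Matrix.vecMul v ((σ⁻¹ : Matrix.GeneralLinearGroup (Fin n) K).1)
          invFun := fun v => Matrix.vecMul v σ.1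
          left_inv := fun v => by
            beta_reduce
            rw [Matrix.vecMul_vecMul, ← Units.val_mul]; simp
          right_inv := fun v => by
            beta_reduce
            rw [Matrix.vecMul_vecMul, ← Units.val_mul]; simp }
      exact e.prod_comp (fun v => Polynomial.X - Polynomial.C (l v))
    conv_rhs => rw [← hmap]
    rw [Polynomial.coeff_map]
    rfl
  refine ⟨fun i => F.coeff (q ^ (i : ℕ)), fun i => q ^ n - q ^ (i : ℕ), fun i => ?_, fun i => ?_,
    fun j => ?_⟩
  · exact Nat.sub_pos_of_lt (Nat.pow_lt_pow_right hq1 i.2)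
  · exact hF.1 _ _ (Nat.add_sub_cancel' (Nat.pow_lt_pow_right hq1 i.2).le)
  · apply mem_radical_of_primes
    intro P t hprime hP
    simp only [hinv] at hP
    have hroot : F.eval (X j) = 0 := by
      simp only [F, Polynomial.eval_prod]
      apply Finset.prod_eq_zero (Finset.mem_univ (Pi.single j 1))
      simp [l, Pi.single_apply]
    rw [hFc, Finset.sum_range_succ, hc1] at hroot
    simp only [Polynomial.eval_add, Polynomial.eval_finsetSum, Polynomial.eval_mul,
      Polynomial.eval_C, Polynomial.eval_pow, Polynomial.eval_X, one_mul] at hroot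
    apply hprime.mem_of_pow_mem (q ^ n)
    rw [eq_neg_of_add_eq_zero_right hroot]
    refine P.neg_mem (P.sum_mem fun i hi => P.mul_mem_right _ ?_)
    have hi' := Finset.mem_range.1 hi
    rw [← hcoef i hi'.le]
    exact hP ⟨i, hi'⟩

theorem exists_homog_lift {n : ℕ} {R K : Type*} [CommRing R] [CommRing K] (π : R →+* K)
    (hπ : Function.Surjective π) (p : MvPolynomial (Fin n) K) (d : ℕ) (hp : p.IsHomogeneous d) :
    ∃ P : MvPolynomial (Fin n) R, P.IsHomogeneous d ∧ MvPolynomial.map π P = p := by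
  obtain ⟨P, hP⟩ := map_surjective π hπ p
  refine ⟨homogeneousComponent d P, homogeneousComponent_isHomogeneous _ _, ?_⟩
  ext v
  rw [coeff_map, coeff_homogeneousComponent]
  split_ifs with hv
  · rw [← coeff_map, hP]
  · rw [map_zero, hp.coeff_eq_zero hv]

/-- Let `R` be a Noetherian local ring and `G ⊆ GLₙ(R)` a finite
subgroup. Then `R[x₁,…,xₙ]^G` contains a homogeneous system of parameters, i.e. there are
homogeneous invariants `f₁,…,fₙ` of positive degree, algebraically independent over `R`,
such that `R[x₁,…,xₙ]^G` is a finitely generated module over `R[f₁,…,fₙ]`. -/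
theorem stmt_7 {n : ℕ} (R : Type*) [CommRing R] [IsNoetherianRing R] [IsLocalRing R]
    (G : Subgroup (Matrix.GeneralLinearGroup (Fin n) R)) [Finite G] :
    ∃ f : Fin n → MvPolynomial (Fin n) R, IsHSOPInv G f := by

  classical
  have := Fintype.ofFinite G
  let π := IsLocalRing.residue R
  have hπ : Function.Surjective π := IsLocalRing.residue_surjective
  obtain ⟨h, d, hd, hh, hX⟩ : ∃ (h : Fin n → MvPolynomial (Fin n) (IsLocalRing.ResidueField R))
      (d : Fin n → ℕ), (∀ i, 0 < d i) ∧ (∀ i, (h i).IsHomogeneous (d i)) ∧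
      ∀ j, X j ∈ (Ideal.span (Set.range fun i =>
        ∏ s : G, glAct (glMap π s.1) (h i))).radical := by
    rcases finite_or_infinite (IsLocalRing.ResidueField R) with hfin | hinf
    · exact exists_h_finite (fun s : G => glMap π s.1)
    · exact exists_h_infinite (fun s : G => glMap π s.1)
  choose H hH hHm using fun i => exists_homog_lift π hπ (h i) (d i) (hh i)
  let f : Fin n → MvPolynomial (Fin n) R := fun i => ∏ σ : G, glAct σ.1 (H i)
  let D : Fin n → ℕ := fun i => ∑ _σ : G, d i
  have hD : ∀ i, 0 < D i := fun i => Finset.sum_pos (fun _ _ => hd i) Finset.univ_nonempty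
  have hf : ∀ i, (f i).IsHomogeneous (D i) := fun i =>
    IsHomogeneous.prod _ _ _ fun σ _ => glAct_homog _ (hH i)
  have hfm : ∀ i, MvPolynomial.map π (f i) = ∏ s : G, glAct (glMap π s.1) (h i) := by
    intro i
    simp only [f, map_prod, glAct_map, hHm]
  have hX' : ∀ j, (X j : MvPolynomial (Fin n) (IsLocalRing.ResidueField R)) ∈
      (Ideal.span (Set.range fun i => MvPolynomial.map π (f i))).radical := by
    simpa only [hfm] using hX
  have hinv : ∀ i, f i ∈ invariants G := fun i => norm_mem_invariants G (H i)
  refine ⟨f, hinv, fun i => ⟨D i, hD i, hf i⟩, ?_, ?_⟩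
  · apply algInd_lift
    exact algInd_field _ D hD (fun i => (hf i).map _) hX'
  · have hfin := finite_of_radical π hπ (by
      rw [IsLocalRing.ker_residue]; exact IsLocalRing.maximalIdeal_le_jacobson _) f D hD hf hX'
    set B := Algebra.adjoin R (Set.range f) with hB
    have hBle : B ≤ invariants G := Algebra.adjoin_le (by rintro _ ⟨i, rfl⟩; exact hinv i)
    have hnoeth : IsNoetherianRing B := by
      have : Algebra.FiniteType R B :=
        (Subalgebra.fg_iff_finiteType _).1
          (Subalgebra.fg_def.2 ⟨Set.range f, Set.finite_range f, rfl⟩)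
      exact Algebra.FiniteType.isNoetherianRing R B
    have : IsNoetherian B (MvPolynomial (Fin n) R) := isNoetherian_of_isNoetherianRing_of_finite _ _
    let N : Submodule B (MvPolynomial (Fin n) R) :=
      { carrier := invariants G
        add_mem' := fun ha hb => (invariants G).add_mem ha hb
        zero_mem' := (invariants G).zero_mem
        smul_mem' := fun b x hx => (invariants G).mul_mem (hBle b.2) hx }
    obtain ⟨s, hs⟩ := IsNoetherian.noetherian N
    refine ⟨s, ?_, ?_⟩
    · intro x hx
      have : x ∈ N := hs ▸ Submodule.subset_span hx
      exact this
    · intro x hx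
      have : x ∈ N := hx
      rw [← hs] at this
      exact this
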